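/- arXiv:2112.03543 — 3 statements merged into one kernel-verified Lean document; each statement's English description precedes it below -/
import Mathlib

section
/- (Symmetry breaking.) Let p < 1/3 and let γ > 0 be any constant. For the 3-Majority dynamics with uniform noise probability p, for any starting configuration with |s_0| ≤ γ·√(n·log n) and all sufficiently large n, with high probability there exists a time τ₂ = O_{γ,p}(log n) such that |s_{τ₂}| ≥ γ·√(n·log n). -/
/-- The probability that a fixed node adopts opinion `beta` in one round of the
`3-Majority` dynamics with uniform communication noise probability `p`, on the complete
graph on `n` nodes, given that the current bias (#beta − #alpha) is `s`.
With `b' = ((n+s)/(2n))·(1−p) + p/2` and `a' = ((n−s)/(2n))·(1−p) + p/2`, it equals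
`b'^3 + 3·a'·b'^2`. -/
noncomputable def qStep (n : ℕ) (p : ℝ) (s : ℤ) : ℝ :=
  ((((n : ℝ) + (s : ℝ)) / (2 * (n : ℝ))) * (1 - p) + p / 2) ^ 3 +
    3 * ((((n : ℝ) - (s : ℝ)) / (2 * (n : ℝ))) * (1 - p) + p / 2) *
      ((((n : ℝ) + (s : ℝ)) / (2 * (n : ℝ))) * (1 - p) + p / 2) ^ 2

/-- Probability that `b_t = k` (i.e. exactly `k` nodes adopt beta), given `s_{t-1} = s`:
the binomial distribution `Binomial(n, qStep n p s)`. -/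
noncomputable def binomProb (n : ℕ) (p : ℝ) (s : ℤ) (k : ℕ) : ℝ :=
  (n.choose k : ℝ) * qStep n p s ^ k * (1 - qStep n p s) ^ (n - k)

open scoped Classical in
/-- One-step probability of the event `A` for the new bias `s_t = 2·b_t − n`,
conditional on `s_{t-1} = s`. -/
noncomputable def stepProb (n : ℕ) (p : ℝ) (s : ℤ) (A : ℤ → Prop) : ℝ :=
  ∑ k ∈ Finset.range (n + 1), if A (2 * (k : ℤ) - (n : ℤ)) then binomProb n p s k else 0

/-- One-step expectation of `f (s_t)` conditional on `s_{t-1} = s`. -/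
noncomputable def stepExp (n : ℕ) (p : ℝ) (s : ℤ) (f : ℤ → ℝ) : ℝ :=
  ∑ k ∈ Finset.range (n + 1), binomProb n p s k * f (2 * (k : ℤ) - (n : ℤ))

/-- The equilibrium bias `s_eq = (n/(1−p))·√((1−3p)/(1−p))`. -/
noncomputable def sEq (n : ℕ) (p : ℝ) : ℝ :=
  ((n : ℝ) / (1 - p)) * Real.sqrt ((1 - 3 * p) / (1 - p))

/-- Bias trajectory: `ω t` records the number of beta-nodes at round `t+1`;
the bias at time `0` is `s0` and at time `t+1` it is `2·(ω t) − n`. -/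
def biasAt (n : ℕ) (s0 : ℤ) (ω : ℕ → Fin (n + 1)) : ℕ → ℤ
  | 0 => s0
  | t + 1 => 2 * ((ω t).val : ℤ) - (n : ℤ)

/-- Probability of the first `t` steps of the trajectory `ω` of the Markov chain started
at bias `s0` (product of one-step binomial probabilities). -/
noncomputable def trajP (n : ℕ) (p : ℝ) (s0 : ℤ) (ω : ℕ → Fin (n + 1)) : ℕ → ℝ
  | 0 => 1
  | t + 1 => trajP n p s0 ω t * binomProb n p (biasAt n s0 ω t) (ω t).val

/-- Extend a finite path to an infinite one (junk after time `T`). -/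
def extendPath (n T : ℕ) (ω : Fin T → Fin (n + 1)) : ℕ → Fin (n + 1) :=
  fun t => if h : t < T then ω ⟨t, h⟩ else 0

open scoped Classical in
/-- Probability that the bias trajectory `(s_0, s_1, …, s_T)` of the 3-Majority Markov
chain with noise `p`, started from `s_0 = s0`, satisfies the event `E`. -/
noncomputable def trajProb (n : ℕ) (p : ℝ) (s0 : ℤ) (T : ℕ) (E : (ℕ → ℤ) → Prop) : ℝ :=
  ∑ ω : Fin T → Fin (n + 1),
    if E (biasAt n s0 (extendPath n T ω)) then trajP n p s0 (extendPath n T ω) T else 0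

/-- expectation under Bin(n,q) -/
noncomputable def bE (q : ℝ) (n : ℕ) (f : ℕ → ℝ) : ℝ :=
  ∑ k ∈ Finset.range (n + 1), (n.choose k : ℝ) * q ^ k * (1 - q) ^ (n - k) * f k

lemma bE_add (q : ℝ) (n : ℕ) (f g : ℕ → ℝ) :
    bE q n (fun k => f k + g k) = bE q n f + bE q n g := by
  simp only [bE, mul_add, Finset.sum_add_distrib]

lemma bE_smul (q : ℝ) (n : ℕ) (a : ℝ) (g : ℕ → ℝ) :
    bE q n (fun k => a * g k) = a * bE q n g := by
  simp only [bE, Finset.mul_sum]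
  exact Finset.sum_congr rfl fun _ _ => by ring

lemma bE_one (q : ℝ) (n : ℕ) : bE q n (fun _ => 1) = 1 := by
  have h := add_pow q (1 - q) n
  simp only [add_sub_cancel, one_pow] at h
  refine Eq.trans ?_ h.symm
  exact Finset.sum_congr rfl fun _ _ => by ring

lemma bE_succ (q : ℝ) (n : ℕ) (f : ℕ → ℝ) :
    bE q (n + 1) f = q * bE q n (fun k => f (k + 1)) + (1 - q) * bE q n f := by
  unfold bE
  rw [Finset.sum_range_succ' _ (n + 1)]
  have h1 : ∀ k ∈ Finset.range (n + 1),
      ((n + 1).choose (k + 1) : ℝ) * q ^ (k + 1) * (1 - q) ^ (n + 1 - (k + 1)) * f (k + 1) =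
      q * ((n.choose k : ℝ) * q ^ k * (1 - q) ^ (n - k) * f (k + 1)) +
      (n.choose (k + 1) : ℝ) * q ^ (k + 1) * (1 - q) ^ (n - k) * f (k + 1) := by
    intro k _
    rw [Nat.choose_succ_succ, Nat.add_sub_add_right]
    push_cast
    ring
  rw [Finset.sum_congr rfl h1, Finset.sum_add_distrib, ← Finset.mul_sum, add_assoc]
  congr 1
  rw [Finset.sum_range_succ, Finset.sum_range_succ' _ n, mul_add, Finset.mul_sum]
  simp only [Nat.choose_succ_self, Nat.cast_zero, zero_mul, add_zero]
  congr 1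
  · refine Finset.sum_congr rfl fun k hk => ?_
    have : n - k = (n - (k + 1)) + 1 := by have := Finset.mem_range.1 hk; omega
    rw [this, pow_succ]; ring
  · simp [pow_succ]; ring

lemma bE_mono {q : ℝ} (h0 : 0 ≤ q) (h1 : q ≤ 1) (n : ℕ) (f g : ℕ → ℝ) (h : ∀ k, f k ≤ g k) :
    bE q n f ≤ bE q n g := by
  unfold bE
  have : 0 ≤ 1 - q := by linarith
  exact Finset.sum_le_sum fun k _ => mul_le_mul_of_nonneg_left (h k) (by positivity)

/-- centred moments -/
lemma bE_mom (q m : ℝ) (hm : m = 2 * q - 1) (n : ℕ) :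
    bE q n (fun k => (2 * (k : ℝ) - n - n * m)) = 0 ∧
    bE q n (fun k => (2 * (k : ℝ) - n - n * m) ^ 2) = n * (1 - m ^ 2) ∧
    bE q n (fun k => (2 * (k : ℝ) - n - n * m) ^ 3) = n * (-2 * m * (1 - m ^ 2)) ∧
    bE q n (fun k => (2 * (k : ℝ) - n - n * m) ^ 4) =
      3 * n ^ 2 * (1 - m ^ 2) ^ 2 + n * ((1 - m ^ 2) * (6 * m ^ 2 - 2)) := by
  have hq : q = (1 + m) / 2 := by linarith
  induction n with
  | zero => simp [bE]
  | succ n ih =>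
    obtain ⟨i1, i2, i3, i4⟩ := ih
    have i0 := bE_one q n
    have key : ∀ (c0 c1 c2 c3 c4 : ℝ) (f : ℕ → ℝ),
        (∀ k : ℕ, f k = c0 * 1 + (c1 * (2 * (k : ℝ) - n - n * m) +
          (c2 * (2 * (k : ℝ) - n - n * m) ^ 2 + (c3 * (2 * (k : ℝ) - n - n * m) ^ 3 +
          c4 * (2 * (k : ℝ) - n - n * m) ^ 4)))) →
        bE q n f = c0 + c2 * (n * (1 - m ^ 2)) + c3 * (n * (-2 * m * (1 - m ^ 2))) +
          c4 * (3 * n ^ 2 * (1 - m ^ 2) ^ 2 + n * ((1 - m ^ 2) * (6 * m ^ 2 - 2))) := by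
      intro c0 c1 c2 c3 c4 f hf
      rw [funext hf, bE_add, bE_add, bE_add, bE_add, bE_smul, bE_smul, bE_smul, bE_smul, bE_smul,
        i0, i1, i2, i3, i4]
      ring
    refine ⟨?_, ?_, ?_, ?_⟩
    · rw [bE_succ, key (1 - m) 1 0 0 0 _ (fun k => by push_cast; ring),
        key (-1 - m) 1 0 0 0 _ (fun k => by push_cast; ring), hq]
      push_cast; ring
    · rw [bE_succ, key ((1 - m) ^ 2) (2 * (1 - m)) 1 0 0 _ (fun k => by push_cast; ring),
        key ((-1 - m) ^ 2) (2 * (-1 - m)) 1 0 0 _ (fun k => by push_cast; ring), hq]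
      push_cast; ring
    · rw [bE_succ, key ((1 - m) ^ 3) (3 * (1 - m) ^ 2) (3 * (1 - m)) 1 0 _
          (fun k => by push_cast; ring),
        key ((-1 - m) ^ 3) (3 * (-1 - m) ^ 2) (3 * (-1 - m)) 1 0 _
          (fun k => by push_cast; ring), hq]
      push_cast; ring
    · rw [bE_succ, key ((1 - m) ^ 4) (4 * (1 - m) ^ 3) (6 * (1 - m) ^ 2) (4 * (1 - m)) 1 _
          (fun k => by push_cast; ring),
        key ((-1 - m) ^ 4) (4 * (-1 - m) ^ 3) (6 * (-1 - m) ^ 2) (4 * (-1 - m)) 1 _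
          (fun k => by push_cast; ring), hq]
      push_cast; ring

lemma tangent (A X : ℝ) (hX : 0 ≤ X) (hA : 0 < A) :
    1 / (1 + X) ≤ 1 / A - (1 + X - A) / A ^ 2 + (1 + X - A) ^ 2 / A ^ 2 := by
  have h1 : 1 / (1 + X) = 1 / A - (1 + X - A) / A ^ 2 + (1 + X - A) ^ 2 / (A ^ 2 * (1 + X)) := by
    field_simp; ring
  rw [h1]
  have : (1 + X - A) ^ 2 / (A ^ 2 * (1 + X)) ≤ (1 + X - A) ^ 2 / A ^ 2 := by
    apply div_le_div_of_nonneg_left (by positivity) (by positivity)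
    nlinarith [sq_nonneg A, mul_nonneg (sq_nonneg A) hX]
  linarith

/-- potential -/
noncomputable def pot (c : ℝ) (n : ℕ) (x : ℝ) : ℝ := 1 / (1 + c * x ^ 2 / n)

lemma bE_pot (q m : ℝ) (hm : m = 2 * q - 1) (h0 : 0 ≤ q) (h1 : q ≤ 1) (n : ℕ) (hn : 0 < n)
    (hm3 : m ^ 2 ≤ 1 / 3) (c : ℝ) (hc : 0 < c) :
    bE q n (fun k => pot c n (2 * (k : ℝ) - n)) ≤
      1 / (1 + c * (n * m ^ 2 + (1 - m ^ 2))) +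
        c ^ 2 * (4 * (n * m ^ 2) + 2) / (1 + c * (n * m ^ 2 + (1 - m ^ 2))) ^ 2 := by
  have hn' : (0 : ℝ) < n := by exact_mod_cast hn
  set A := 1 + c * (n * m ^ 2 + (1 - m ^ 2)) with hA
  have hA0 : 0 < A := by
    have : 0 ≤ c * (n * m ^ 2 + (1 - m ^ 2)) := by
      apply mul_nonneg hc.le
      have : 0 ≤ n * m ^ 2 := by positivity
      linarith
    linarith
  obtain ⟨i1, i2, i3, i4⟩ := bE_mom q m hm n
  have i0 := bE_one q n
  set v := 1 - m ^ 2 with hv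
  -- 1 + X - A = (c/n) (2 n m D + D^2 - n v)
  let a0 := 1 / A + c * v / A ^ 2 + c ^ 2 * v ^ 2 / A ^ 2
  let a1 := - (2 * c * m) / A ^ 2 - 4 * c ^ 2 * m * v / A ^ 2
  let a2 := - (c / n) / A ^ 2 + (4 * c ^ 2 * m ^ 2 - 2 * c ^ 2 * v / n) / A ^ 2
  let a3 := (4 * c ^ 2 * m / n) / A ^ 2
  let a4 := (c ^ 2 / n ^ 2) / A ^ 2
  have hpt : ∀ k : ℕ, pot c n (2 * (k : ℝ) - n) ≤ a0 * 1 + (a1 * (2 * (k : ℝ) - n - n * m) +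
          (a2 * (2 * (k : ℝ) - n - n * m) ^ 2 + (a3 * (2 * (k : ℝ) - n - n * m) ^ 3 +
          a4 * (2 * (k : ℝ) - n - n * m) ^ 4))) := by
    intro k
    refine (tangent A _ (by positivity) hA0).trans (le_of_eq ?_)
    set D := 2 * (k : ℝ) - n - n * m with hD
    have hk : 2 * (k : ℝ) - n = D + n * m := by rw [hD]; ring
    have hX : 1 + c * (2 * (k : ℝ) - n) ^ 2 / n - A = c / n * (2 * n * m * D + D ^ 2 - n * v) := by
      rw [hk, hA]; field_simp; ring
    rw [hX]
    simp only [a0, a1, a2, a3, a4]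
    field_simp
    ring
  refine (bE_mono h0 h1 n _ _ hpt).trans ?_
  rw [bE_add, bE_add, bE_add, bE_add, bE_smul, bE_smul, bE_smul, bE_smul, bE_smul,
        i0, i1, i2, i3, i4]
  have e : a0 * 1 + (a1 * 0 + (a2 * (n * v) + (a3 * (n * (-2 * m * v)) +
      a4 * (3 * n ^ 2 * v ^ 2 + n * (v * (6 * m ^ 2 - 2)))))) =
      1 / A + c ^ 2 * (4 * (n * m ^ 2) * v - 8 * m ^ 2 * v + 2 * v ^ 2
        + v * (6 * m ^ 2 - 2) / n) / A ^ 2 := by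
    simp only [a0, a1, a2, a3, a4]
    field_simp
    ring
  rw [e]
  have hv0 : 0 ≤ v := by rw [hv]; linarith
  have hv1 : v ≤ 1 := by rw [hv]; nlinarith [sq_nonneg m]
  have t1 : v * (6 * m ^ 2 - 2) / n ≤ 0 :=
    div_nonpos_of_nonpos_of_nonneg (mul_nonpos_of_nonneg_of_nonpos hv0 (by linarith)) hn'.le
  have t2 : 4 * (n * m ^ 2) * v ≤ 4 * (n * m ^ 2) :=
    mul_le_of_le_one_right (by positivity) hv1
  have t3 : 0 ≤ 8 * m ^ 2 * v := by positivity
  have t4 : v ^ 2 ≤ 1 := by nlinarith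
  have t5 : 4 * (n * m ^ 2) * v - 8 * m ^ 2 * v + 2 * v ^ 2 + v * (6 * m ^ 2 - 2) / n ≤
      4 * (n * m ^ 2) + 2 := by linarith
  have t6 := div_le_div_of_nonneg_right (mul_le_mul_of_nonneg_left t5 (sq_nonneg c)) (sq_nonneg A)
  linarith

lemma arith (c κ M v w : ℝ) (hc : 0 < c) (hκ : 16 * c ≤ 1 - κ) (hκ0 : 0 ≤ κ) (hM : 0 ≤ M)
    (hv : 1 / 2 ≤ v) (hw0 : 0 ≤ w) (hw : w ≤ κ * M) :
    1 / (1 + c * (M + v)) + c ^ 2 * (4 * M + 2) / (1 + c * (M + v)) ^ 2 ≤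
      (1 - c / 4) * (1 / (1 + c * w)) := by
  set A := 1 + c * (M + v) with hA
  have hcM : 0 ≤ c * M := by positivity
  have hcv : c / 2 ≤ c * v := by nlinarith
  have hA1 : 1 ≤ A := by rw [hA]; nlinarith
  have hA0 : 0 < A := by linarith
  have hc16 : c ≤ 1 / 16 := by linarith
  have hcw : c * w ≤ κ * (c * M) := by nlinarith
  have e : 1 / A + c ^ 2 * (4 * M + 2) / A ^ 2 = (A + c ^ 2 * (4 * M + 2)) / A ^ 2 := by
    field_simp
  rw [e, mul_one_div, div_le_div_iff₀ (by positivity) (by positivity)]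
  have hR : 0 ≤ c ^ 2 * (4 * M + 2) := by positivity
  have h1 : c ^ 2 * (4 * M + 2) ≤ 4 * c * A := by rw [hA]; nlinarith
  have h2 : (A + c ^ 2 * (4 * M + 2)) * (1 + c * w) ≤
      (A + c ^ 2 * (4 * M + 2)) * (1 + κ * (c * M)) :=
    mul_le_mul_of_nonneg_left (by linarith) (by positivity)
  have h3 : κ * (c * M) * (c ^ 2 * (4 * M + 2)) ≤ (c * M) * (4 * c * A) := by
    apply mul_le_mul _ h1 hR hcM
    nlinarith
  have h4 : c ^ 2 * (4 * M + 2) ≤ A * (c ^ 2 * (4 * M + 2)) := by nlinarith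
  have h5 : (A + c ^ 2 * (4 * M + 2)) * (1 + κ * (c * M)) ≤
      A * (1 + 2 * c ^ 2 + c * M * (κ + 8 * c)) := by nlinarith
  have h6 : 1 + 2 * c ^ 2 + c * M * (κ + 8 * c) ≤ (1 - c / 4) * A := by
    have a1 : c * M * (κ + 8 * c) ≤ (c * M) * (1 - c / 4) :=
      mul_le_mul_of_nonneg_left (by linarith) hcM
    have a2 : (1 - c / 4) * (1 + c * M + c / 2) ≤ (1 - c / 4) * A :=
      mul_le_mul_of_nonneg_left (by rw [hA]; linarith) (by linarith)
    nlinarith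
  calc _ ≤ _ := h2
    _ ≤ _ := h5
    _ ≤ A * ((1 - c / 4) * A) := mul_le_mul_of_nonneg_left h6 hA0.le
    _ = _ := by ring

lemma qStep_eq (n : ℕ) (hn : 0 < n) (p : ℝ) (s : ℤ) :
    2 * qStep n p s - 1 = (3 * ((1 - p) * (s / n)) - ((1 - p) * (s / n)) ^ 3) / 2 := by
  have hn' : (n : ℝ) ≠ 0 := by positivity
  unfold qStep
  field_simp
  ring

lemma qStep_mem (n : ℕ) (hn : 0 < n) (p : ℝ) (hp0 : 0 < p) (hp : p < 1 / 3) (s : ℤ)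
    (hs : |s| ≤ (n : ℤ)) : 0 ≤ qStep n p s ∧ qStep n p s ≤ 1 := by
  have hn' : (0 : ℝ) < n := by positivity
  have h := qStep_eq n hn p s
  have hs' : |(s : ℝ)| ≤ n := by exact_mod_cast hs
  obtain ⟨h1, h2⟩ := abs_le.1 hs'
  have b1 : (s : ℝ) / n ≤ 1 := by rw [div_le_one hn']; exact h2
  have b2 : -1 ≤ (s : ℝ) / n := by rw [le_div_iff₀ hn']; linarith
  set y := (1 - p) * ((s : ℝ) / n) with hy
  have y1 : y ≤ 1 := by nlinarith
  have y2 : -1 ≤ y := by nlinarith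
  constructor
  · nlinarith [mul_nonneg (sq_nonneg (y + 1)) (by linarith : (0 : ℝ) ≤ 2 - y)]
  · nlinarith [mul_nonneg (sq_nonneg (y - 1)) (by linarith : (0 : ℝ) ≤ 2 + y)]

set_option maxHeartbeats 2000000 in
lemma step_pot (p : ℝ) (hp0 : 0 < p) (hp : p < 1 / 3) :
    ∃ c e : ℝ, 0 < c ∧ c ≤ 1 ∧ 0 < e ∧ ∀ n : ℕ, 0 < n → ∀ s : ℤ, |s| ≤ (n : ℤ) →
      (s : ℝ) ^ 2 ≤ e * n ^ 2 →
      bE (qStep n p s) n (fun k => pot c n (2 * (k : ℝ) - n)) ≤ (1 - c / 4) * pot c n s := by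
  obtain ⟨l, hl⟩ : ∃ l : ℝ, l = 3 / 2 * (1 - p) := ⟨_, rfl⟩
  have hl1 : 1 < l := by rw [hl]; linarith
  have hl2 : l < 3 / 2 := by rw [hl]; linarith
  obtain ⟨l', hl'⟩ : ∃ l' : ℝ, l' = (l + 1) / 2 := ⟨_, rfl⟩
  have hl'1 : 1 < l' := by linarith
  have hκ1 : 1 / l' ^ 2 < 1 := by
    rw [div_lt_one (by positivity)]; nlinarith
  refine ⟨(1 - 1 / l' ^ 2) / 16, (l - 1) / 4, by linarith, ?_, by linarith, ?_⟩
  · have : 0 ≤ 1 / l' ^ 2 := by positivity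
    linarith
  intro n hn s hs hse
  have hn' : (0 : ℝ) < n := by positivity
  obtain ⟨q0, q1⟩ := qStep_mem n hn p hp0 hp s hs
  have hm := qStep_eq n hn p s
  set m := 2 * qStep n p s - 1 with hmdef
  set c := (1 - 1 / l' ^ 2) / 16 with hc
  set x := (s : ℝ) / n with hx
  have hx2 : x ^ 2 ≤ (l - 1) / 4 := by
    rw [hx, div_pow, div_le_iff₀ (by positivity)]; exact hse
  have hy2 : ((1 - p) * x) ^ 2 ≤ x ^ 2 := by
    rw [mul_pow]; apply mul_le_of_le_one_left (sq_nonneg x); nlinarith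
  have hy0 := sq_nonneg ((1 - p) * x)
  have hmx : m = x * (l - (1 - p) * ((1 - p) * x) ^ 2 / 2) := by
    rw [hm, hl]; ring
  obtain ⟨r, hr⟩ : ∃ r : ℝ, r = l - (1 - p) * ((1 - p) * x) ^ 2 / 2 := ⟨_, rfl⟩
  have hr1 : l' ≤ r := by rw [hr, hl']; nlinarith
  have hr2 : r ≤ 3 / 2 := by rw [hr]; nlinarith
  rw [← hr] at hmx
  have hm2 : m ^ 2 = x ^ 2 * r ^ 2 := by rw [hmx]; ring
  have hr3 : l' ^ 2 ≤ r ^ 2 := by nlinarith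
  have hr4 : r ^ 2 ≤ 9 / 4 := by nlinarith
  have hm3 : m ^ 2 ≤ 1 / 3 := by
    rw [hm2]; nlinarith [sq_nonneg x, sq_nonneg r]
  have hcpos : 0 < c := by rw [hc]; linarith
  refine (bE_pot _ m hmdef q0 q1 n hn hm3 c hcpos).trans ?_
  have hw : c * (s : ℝ) ^ 2 / n = c * (n * x ^ 2) := by
    rw [hx]; field_simp
  unfold pot
  rw [hw]
  refine arith c (1 / l' ^ 2) (n * m ^ 2) (1 - m ^ 2) (n * x ^ 2) hcpos (by rw [hc]; linarith)
    (by positivity) (by positivity) (by linarith) (by positivity) ?_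
  rw [hm2, div_mul_eq_mul_div, one_mul, le_div_iff₀ (by positivity)]
  have : 0 ≤ n * x ^ 2 := by positivity
  nlinarith

lemma extendPath_snoc (n T : ℕ) (ω : Fin T → Fin (n + 1)) (k : Fin (n + 1)) :
    extendPath n (T + 1) (Fin.snoc (α := fun _ => Fin (n + 1)) ω k) =
      Function.update (extendPath n T ω) T k := by
  funext t
  unfold extendPath
  rcases lt_trichotomy t T with h | h | h
  · rw [Function.update_of_ne h.ne, dif_pos h, dif_pos (by omega)]
    simp [Fin.snoc, h]
  · subst h
    simp [Fin.snoc]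
  · rw [Function.update_of_ne h.ne', dif_neg (by omega), dif_neg (by omega)]

lemma pathSum_succ (n T : ℕ) (G : (ℕ → Fin (n + 1)) → ℝ) :
    ∑ ω : Fin (T + 1) → Fin (n + 1), G (extendPath n (T + 1) ω) =
      ∑ ω : Fin T → Fin (n + 1), ∑ k : Fin (n + 1),
        G (Function.update (extendPath n T ω) T k) := by
  rw [← (Fin.snocEquiv (fun _ : Fin (T + 1) => Fin (n + 1))).sum_comp, Fintype.sum_prod_type_right]
  refine Finset.sum_congr rfl fun ω _ => Finset.sum_congr rfl fun k _ => ?_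
  rw [← extendPath_snoc]
  rfl

lemma biasAt_update (n : ℕ) (s0 : ℤ) (ω : ℕ → Fin (n + 1)) (T : ℕ) (k : Fin (n + 1)) (t : ℕ)
    (ht : t ≤ T) : biasAt n s0 (Function.update ω T k) t = biasAt n s0 ω t := by
  cases t with
  | zero => rfl
  | succ t =>
    simp only [biasAt]
    rw [Function.update_of_ne (by omega)]

lemma trajP_update (n : ℕ) (p : ℝ) (s0 : ℤ) (ω : ℕ → Fin (n + 1)) (T : ℕ) (k : Fin (n + 1))
    (t : ℕ) (ht : t ≤ T) : trajP n p s0 (Function.update ω T k) t = trajP n p s0 ω t := by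
  induction t with
  | zero => rfl
  | succ t ih =>
    simp only [trajP]
    rw [ih (by omega), biasAt_update _ _ _ _ _ _ (by omega), Function.update_of_ne (by omega)]

lemma biasAt_abs (n : ℕ) (s0 : ℤ) (hs : |s0| ≤ (n : ℤ)) (ω : ℕ → Fin (n + 1)) (t : ℕ) :
    |biasAt n s0 ω t| ≤ (n : ℤ) := by
  cases t with
  | zero => exact hs
  | succ t =>
    simp only [biasAt]
    have := (ω t).isLt
    rw [abs_le]
    constructor <;> omega

lemma trajP_nonneg (n : ℕ) (hn : 0 < n) (p : ℝ) (hp0 : 0 < p) (hp : p < 1 / 3) (s0 : ℤ)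
    (hs : |s0| ≤ (n : ℤ)) (ω : ℕ → Fin (n + 1)) (t : ℕ) : 0 ≤ trajP n p s0 ω t := by
  induction t with
  | zero => simp [trajP]
  | succ t ih =>
    simp only [trajP]
    obtain ⟨q0, q1⟩ := qStep_mem n hn p hp0 hp _ (biasAt_abs n s0 hs ω t)
    have q2 : 0 ≤ 1 - qStep n p (biasAt n s0 ω t) := by linarith
    unfold binomProb
    positivity

lemma sum_binom (n : ℕ) (p : ℝ) (s : ℤ) (f : ℕ → ℝ) :
    ∑ k : Fin (n + 1), binomProb n p s k.val * f k.val = bE (qStep n p s) n f := by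
  rw [Fin.sum_univ_eq_sum_range (fun k => binomProb n p s k * f k)]
  rfl

lemma trajP_total (n : ℕ) (p : ℝ) (s0 : ℤ) (T : ℕ) :
    ∑ ω : Fin T → Fin (n + 1), trajP n p s0 (extendPath n T ω) T = 1 := by
  induction T with
  | zero => simp [trajP]
  | succ T ih =>
    rw [pathSum_succ n T (fun w => trajP n p s0 w (T + 1)), ← ih]
    refine Finset.sum_congr rfl fun ω _ => ?_
    have h := sum_binom n p (biasAt n s0 (extendPath n T ω) T) (fun _ => 1)
    rw [bE_one] at h
    simp only [mul_one] at h
    simp only [trajP, trajP_update n p s0 _ T _ T le_rfl, biasAt_update n s0 _ T _ T le_rfl,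
      Function.update_self]
    rw [← Finset.mul_sum, h, mul_one]

lemma pot_nonneg (c : ℝ) (hc : 0 < c) (n : ℕ) (x : ℝ) : 0 ≤ pot c n x := by
  unfold pot; positivity

open scoped Classical in
lemma pot_decay (n : ℕ) (hn : 0 < n) (p : ℝ) (hp0 : 0 < p) (hp : p < 1 / 3) (s0 : ℤ)
    (hs : |s0| ≤ (n : ℤ)) (c ρ L : ℝ) (hc : 0 < c) (hρ : 0 ≤ ρ)
    (hstep : ∀ s : ℤ, |s| ≤ (n : ℤ) → |(s : ℝ)| < L →
      bE (qStep n p s) n (fun k => pot c n (2 * (k : ℝ) - n)) ≤ ρ * pot c n s) (T : ℕ) :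
    ∑ ω : Fin T → Fin (n + 1), (if ∀ t < T, |(biasAt n s0 (extendPath n T ω) t : ℝ)| < L then
      trajP n p s0 (extendPath n T ω) T * pot c n (biasAt n s0 (extendPath n T ω) T) else 0)
      ≤ ρ ^ T := by
  induction T with
  | zero =>
    simp only [Nat.not_lt_zero, IsEmpty.forall_iff, implies_true, if_true, trajP, one_mul, pow_zero,
      Finset.univ_unique, Finset.sum_singleton, pot]
    apply div_le_one_of_le₀ _ (by positivity)
    exact le_add_of_nonneg_right (by positivity)
  | succ T ih =>
    rw [pathSum_succ n T (fun w => if ∀ t < T + 1, |(biasAt n s0 w t : ℝ)| < L then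
      trajP n p s0 w (T + 1) * pot c n (biasAt n s0 w (T + 1)) else 0), pow_succ']
    refine le_trans ?_ (mul_le_mul_of_nonneg_left ih hρ)
    rw [Finset.mul_sum]
    refine Finset.sum_le_sum fun ω _ => ?_
    set w := extendPath n T ω
    have hP := trajP_nonneg n hn p hp0 hp s0 hs w T
    by_cases hL : ∀ t < T + 1, |(biasAt n s0 w t : ℝ)| < L
    · have hL' : ∀ t < T, |(biasAt n s0 w t : ℝ)| < L := fun t ht => hL t (by omega)
      rw [if_pos hL']
      have e : ∀ k : Fin (n + 1),
          (if ∀ t < T + 1, |(biasAt n s0 (Function.update w T k) t : ℝ)| < L then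
            trajP n p s0 (Function.update w T k) (T + 1) *
              pot c n (biasAt n s0 (Function.update w T k) (T + 1)) else 0) =
          trajP n p s0 w T * (binomProb n p (biasAt n s0 w T) k.val *
            (fun k : ℕ => pot c n (2 * (k : ℝ) - n)) k.val) := by
        intro k
        rw [if_pos]
        · simp only [trajP, trajP_update n p s0 _ T _ T le_rfl, biasAt_update n s0 _ T _ T le_rfl]
          simp only [biasAt, Function.update_self]
          push_cast
          ring
        · intro t ht
          rw [biasAt_update n s0 _ T _ t (by omega)]
          exact hL t ht
      rw [Finset.sum_congr rfl fun k _ => e k, ← Finset.mul_sum]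
      refine (le_of_eq (congrArg (trajP n p s0 w T * ·) (sum_binom n p (biasAt n s0 w T)
        (fun k : ℕ => pot c n (2 * (k : ℝ) - n))))).trans ?_
      beta_reduce
      have := mul_le_mul_of_nonneg_left
        (hstep _ (biasAt_abs n s0 hs w T) (hL T (by omega))) hP
      linarith
    · have e : ∀ k : Fin (n + 1),
          (if ∀ t < T + 1, |(biasAt n s0 (Function.update w T k) t : ℝ)| < L then
            trajP n p s0 (Function.update w T k) (T + 1) *
              pot c n (biasAt n s0 (Function.update w T k) (T + 1)) else 0) = 0 := by
        intro k
        rw [if_neg]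
        intro h
        apply hL
        intro t ht
        rw [← biasAt_update n s0 _ T k t (by omega)]
        exact h t ht
      rw [Finset.sum_congr rfl fun k _ => e k, Finset.sum_const_zero]
      apply mul_nonneg hρ
      split_ifs
      · exact mul_nonneg hP (pot_nonneg c hc n _)
      · exact le_rfl

open scoped Classical in
lemma hit_bound (n : ℕ) (hn : 0 < n) (p : ℝ) (hp0 : 0 < p) (hp : p < 1 / 3) (s0 : ℤ)
    (hs : |s0| ≤ (n : ℤ)) (c ρ L : ℝ) (hc : 0 < c) (hρ : 0 ≤ ρ)
    (hstep : ∀ s : ℤ, |s| ≤ (n : ℤ) → |(s : ℝ)| < L →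
      bE (qStep n p s) n (fun k => pot c n (2 * (k : ℝ) - n)) ≤ ρ * pot c n s) (T : ℕ)
    (E : (ℕ → ℤ) → Prop) (hE : ∀ σ, ¬ E σ → ∀ t < T, |(σ t : ℝ)| < L) :
    1 - (1 + c * n) * ρ ^ T ≤ trajProb n p s0 T E := by
  have hn' : (0 : ℝ) < n := by positivity
  have h1 := pot_decay n hn p hp0 hp s0 hs c ρ L hc hρ hstep T
  have h2 := mul_le_mul_of_nonneg_left h1 (by positivity : 0 ≤ 1 + c * n)
  refine (sub_le_sub_left h2 1).trans ?_
  refine (le_of_eq (congrArg (· - _) (trajP_total n p s0 T).symm)).trans ?_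
  beta_reduce
  rw [Finset.mul_sum, ← Finset.sum_sub_distrib]
  unfold trajProb
  refine Finset.sum_le_sum fun ω _ => ?_
  set w := extendPath n T ω
  have hP := trajP_nonneg n hn p hp0 hp s0 hs w T
  have hV := pot_nonneg c hc n (biasAt n s0 w T)
  by_cases h : E (biasAt n s0 w)
  · rw [if_pos h, sub_le_self_iff]
    apply mul_nonneg (by positivity)
    split_ifs
    · exact mul_nonneg hP hV
    · exact le_rfl
  · rw [if_neg h, if_pos (hE _ h)]
    have hb : |(biasAt n s0 w T : ℝ)| ≤ n := by exact_mod_cast biasAt_abs n s0 hs w T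
    have hb2 : (biasAt n s0 w T : ℝ) ^ 2 ≤ n ^ 2 := sq_le_sq' (abs_le.1 hb).1 (abs_le.1 hb).2
    have : 1 ≤ (1 + c * n) * pot c n (biasAt n s0 w T) := by
      unfold pot
      rw [mul_one_div, one_le_div (by positivity)]
      have : c * (biasAt n s0 w T : ℝ) ^ 2 / n ≤ c * n := by
        rw [div_le_iff₀ hn']; nlinarith
      linarith
    nlinarith

/-- Symmetry breaking. Let `p < 1/3` and `γ > 0`. For every
sufficiently large `n` and every starting bias with `|s0| ≤ γ√(n log n)`, with
probability at least `1 − n^{−β}` there is a time `τ₂ ≤ C log n` such that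
`|s_{τ₂}| ≥ γ√(n log n)`. -/
theorem symmetry_breaking
    (p : ℝ) (hp0 : 0 < p) (hp : p < 1 / 3) (γ : ℝ) (hγ : 0 < γ) :
    ∃ C β : ℝ, 0 < C ∧ 0 < β ∧
      ∃ N : ℕ, ∀ n : ℕ, N ≤ n → ∀ s0 : ℤ,
        |(s0 : ℝ)| ≤ γ * Real.sqrt (n * Real.log n) → |s0| ≤ (n : ℤ) →
        1 - (n : ℝ) ^ (-β) ≤
          trajProb n p s0 ⌈C * Real.log n⌉₊
            (fun σ => ∃ τ : ℕ, (τ : ℝ) ≤ C * Real.log n ∧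
              γ * Real.sqrt (n * Real.log n) ≤ |(σ τ : ℝ)|) := by
  obtain ⟨c, e, hc, hc1, he, hstep⟩ := step_pot p hp0 hp
  have hlog : ∀ᶠ n : ℕ in Filter.atTop, ‖Real.log n‖ ≤ (e / γ ^ 2) * ‖(n : ℝ)‖ :=
    ((Real.isLittleO_log_id_atTop.comp_tendsto tendsto_natCast_atTop_atTop).def
      (by positivity : 0 < e / γ ^ 2))
  obtain ⟨N, hN⟩ := Filter.eventually_atTop.1 hlog
  refine ⟨12 / c, 1, by positivity, one_pos, max N 2, ?_⟩
  intro n hn s0 _ hs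
  have hn2 : 2 ≤ n := le_trans (le_max_right _ _) hn
  have hnpos : 0 < n := by omega
  have hn' : (2 : ℝ) ≤ n := by exact_mod_cast hn2
  have hl := hN n (le_trans (le_max_left _ _) hn)
  have hlog0 : 0 ≤ Real.log n := Real.log_nonneg (by linarith)
  rw [Real.norm_of_nonneg hlog0, Real.norm_of_nonneg (by linarith)] at hl
  set L := γ * Real.sqrt (n * Real.log n) with hL
  have hL2 : L ^ 2 ≤ e * n ^ 2 := by
    rw [hL, mul_pow, Real.sq_sqrt (by positivity)]
    calc γ ^ 2 * (n * Real.log n) ≤ γ ^ 2 * (n * (e / γ ^ 2 * n)) := by gcongr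
      _ = e * n ^ 2 := by field_simp
  set T := ⌈12 / c * Real.log n⌉₊ with hT
  have hb := hit_bound n hnpos p hp0 hp s0 hs c (1 - c / 4) L hc (by linarith)
    (fun s h1 h2 => hstep n hnpos s h1 (by
      have := sq_lt_sq' (abs_lt.1 h2).1 (abs_lt.1 h2).2
      linarith)) T
    (fun σ => ∃ τ : ℕ, (τ : ℝ) ≤ 12 / c * Real.log n ∧ L ≤ |(σ τ : ℝ)|)
    (fun σ hσ t ht => by
      by_contra hcon
      exact hσ ⟨t, (Nat.lt_ceil.1 ht).le, not_lt.1 hcon⟩)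
  refine le_trans ?_ hb
  have hTle : 12 / c * Real.log n ≤ T := Nat.le_ceil _
  have hpow : (1 - c / 4) ^ T ≤ ((n : ℝ) ^ 3)⁻¹ := by
    calc (1 - c / 4) ^ T ≤ (Real.exp (-(c / 4))) ^ T :=
          pow_le_pow_left₀ (by linarith) (Real.one_sub_le_exp_neg _) T
      _ = Real.exp (-(c / 4 * T)) := by rw [← Real.exp_nat_mul]; congr 1; ring
      _ ≤ Real.exp (-(3 * Real.log n)) := by
          apply Real.exp_le_exp.2
          have := mul_le_mul_of_nonneg_left hTle (by positivity : 0 ≤ c / 4)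
          have e2 : c / 4 * (12 / c * Real.log n) = 3 * Real.log n := by field_simp; ring
          linarith
      _ = ((n : ℝ) ^ 3)⁻¹ := by
          rw [Real.exp_neg]
          congr 1
          rw [show (3 : ℝ) * Real.log n = ((3 : ℕ) : ℝ) * Real.log n by norm_num,
            Real.exp_nat_mul, Real.exp_log (by linarith)]
  have hfin : (1 + c * n) * (1 - c / 4) ^ T ≤ (n : ℝ) ^ (-1 : ℝ) := by
    rw [Real.rpow_neg_one]
    calc (1 + c * n) * (1 - c / 4) ^ T ≤ (n ^ 2) * ((n : ℝ) ^ 3)⁻¹ := by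
          apply mul_le_mul _ hpow (pow_nonneg (by linarith) _) (by positivity)
          nlinarith
      _ = (n : ℝ)⁻¹ := by field_simp
  linarith
end

section
/- Let p < 1/3 and let γ > 0 and 0 < ε < 1 be constants. For the 3-Majority dynamics with uniform noise probability p, if s is a bias value with s ≥ γ·√(n·log n) and s ≥ (1−ε)·s_eq, then P( s_t ≤ (1 + ε)·s | s_{t−1} = s ) ≥ 1 − n^{−γ²ε²p²}. -/
/-- Chernoff-type tail bound for the binomial distribution. -/
theorem aux_tail (n : ℕ) (q t d : ℝ) (hq0 : 0 ≤ q) (hq1 : q ≤ 1) (ht0 : 0 ≤ t) (ht1 : t ≤ 1) :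
    ∑ k ∈ Finset.range (n + 1), ((n.choose k : ℝ) * q ^ k * (1 - q) ^ (n - k)) *
      Real.exp (t * ((k : ℝ) - n * q - d)) ≤ Real.exp (n * (t ^ 2 / 4) - t * d) := by
  have hexp : ∀ u : ℝ, |u| ≤ 1 → Real.exp u ≤ 1 + u + u ^ 2 := by
    intro u hu
    have := Real.abs_exp_sub_one_sub_id_le hu
    have := (abs_le.1 this).2
    linarith
  have hmgf : q * Real.exp (t * (1 - q)) + (1 - q) * Real.exp (-(t * q)) ≤
      Real.exp (t ^ 2 / 4) := by
    have h1 := hexp (t * (1 - q)) (by rw [abs_le]; constructor <;> nlinarith)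
    have h2 := hexp (-(t * q)) (by rw [abs_le]; constructor <;> nlinarith)
    have h3 := mul_le_mul_of_nonneg_left h1 hq0
    have h4 := mul_le_mul_of_nonneg_left h2 (sub_nonneg.2 hq1)
    have h5 := Real.add_one_le_exp (t ^ 2 / 4)
    have h6 : 0 ≤ (t * (2 * q - 1)) ^ 2 := sq_nonneg _
    nlinarith
  have hnn : 0 ≤ q * Real.exp (t * (1 - q)) + (1 - q) * Real.exp (-(t * q)) := by
    have := sub_nonneg.2 hq1
    positivity
  have hpow := pow_le_pow_left₀ hnn hmgf n
  rw [← Real.exp_nat_mul, add_pow] at hpow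
  have heq : ∑ k ∈ Finset.range (n + 1), ((n.choose k : ℝ) * q ^ k * (1 - q) ^ (n - k)) *
      Real.exp (t * ((k : ℝ) - n * q - d)) =
      (∑ m ∈ Finset.range (n + 1), (q * Real.exp (t * (1 - q))) ^ m *
        ((1 - q) * Real.exp (-(t * q))) ^ (n - m) * (n.choose m : ℝ)) * Real.exp (-(t * d)) := by
    rw [Finset.sum_mul]
    apply Finset.sum_congr rfl
    intro k hk
    have hkn : k ≤ n := by simpa [Nat.lt_succ_iff] using hk
    rw [mul_pow, mul_pow, ← Real.exp_nat_mul, ← Real.exp_nat_mul]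
    have : Real.exp (t * ((k : ℝ) - n * q - d)) = Real.exp (k * (t * (1 - q))) *
        Real.exp (((n - k : ℕ) : ℝ) * (-(t * q))) * Real.exp (-(t * d)) := by
      rw [← Real.exp_add, ← Real.exp_add, Nat.cast_sub hkn]
      congr 1
      ring
    rw [this]
    ring
  rw [heq, sub_eq_add_neg (_ * _ : ℝ) (t * d), Real.exp_add]
  exact mul_le_mul_of_nonneg_right hpow (Real.exp_pos _).le

theorem aux_sum (n : ℕ) (p : ℝ) (s : ℤ) :
    ∑ k ∈ Finset.range (n + 1), binomProb n p s k = 1 := by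
  have h := add_pow (qStep n p s) (1 - qStep n p s) n
  rw [add_sub_cancel, one_pow] at h
  rw [h]
  apply Finset.sum_congr rfl
  intro k _
  unfold binomProb
  ring

theorem aux_q (n : ℕ) (p : ℝ) (s : ℤ) (hn : (n : ℝ) ≠ 0) :
    qStep n p s = (1 + (3 * ((1 - p) * (s / n)) - ((1 - p) * (s / n)) ^ 3) / 2) / 2 := by
  unfold qStep
  field_simp
  ring

/-- Let `p < 1/3`, `γ > 0` and `0 < ε < 1`. If `s ≥ γ√(n log n)` and
`s ≥ (1−ε)s_eq`, then `P(s_t ≤ (1+ε)s | s_{t−1} = s) ≥ 1 − n^{−γ²ε²p²}`. -/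
theorem bias_does_not_increase_too_much
    (p ε γ : ℝ) (hp0 : 0 < p) (hp : p < 1 / 3)
    (hε0 : 0 < ε) (hε1 : ε < 1) (hγ : 0 < γ)
    (n : ℕ) (s : ℤ)
    (hs1 : γ * Real.sqrt (n * Real.log n) ≤ (s : ℝ))
    (hs2 : (1 - ε) * sEq n p ≤ (s : ℝ)) :
    1 - (n : ℝ) ^ (-(γ ^ 2 * ε ^ 2 * p ^ 2)) ≤
      stepProb n p s (fun x => (x : ℝ) ≤ (1 + ε) * (s : ℝ)) := by
  by_cases hbig : (n : ℤ) ≤ s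
  · -- the event is certain
    have h1 : stepProb n p s (fun x => (x : ℝ) ≤ (1 + ε) * (s : ℝ)) = 1 := by
      unfold stepProb
      refine Eq.trans ?_ (aux_sum n p s)
      apply Finset.sum_congr rfl
      intro k hk
      have hkn : k ≤ n := by simpa [Nat.lt_succ_iff] using hk
      rw [if_pos]
      have h2 : ((2 * (k : ℤ) - (n : ℤ) : ℤ) : ℝ) ≤ (s : ℝ) := by
        exact_mod_cast (by lia : 2 * (k : ℤ) - (n : ℤ) ≤ s)
      have h3 : (0 : ℝ) ≤ s := by exact_mod_cast (by lia : 0 ≤ s)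
      nlinarith
    rw [h1]
    have := Real.rpow_nonneg (Nat.cast_nonneg (α := ℝ) n) (-(γ ^ 2 * ε ^ 2 * p ^ 2))
    linarith
  push Not at hbig
  have hs0 : (0 : ℝ) ≤ s := le_trans (by positivity) hs1
  have hsn : (s : ℝ) < n := by exact_mod_cast hbig
  have hn0 : (0 : ℝ) < n := lt_of_le_of_lt hs0 hsn
  have hn1 : (1 : ℝ) ≤ n := by exact_mod_cast (Nat.cast_pos.1 hn0)
  have hq := aux_q n p s hn0.ne'
  set x : ℝ := (s : ℝ) / n with hx
  have hx0 : 0 ≤ x := by positivity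
  have hx1 : x ≤ 1 := (div_le_one hn0).2 hsn.le
  have hsx : (s : ℝ) = n * x := by rw [hx]; field_simp
  set y : ℝ := (1 - p) * x with hy
  have hy0 : 0 ≤ y := mul_nonneg (by linarith) hx0
  have hy1 : y ≤ 1 := by nlinarith
  set q := qStep n p s with hqdef
  have hq0 : 0 ≤ q := by
    rw [hq]
    nlinarith [mul_nonneg hy0 (mul_nonneg (sub_nonneg.2 hy1) (by linarith : 0 ≤ 1 + y))]
  have hq1 : q ≤ 1 := by
    rw [hq]
    nlinarith [mul_nonneg (sq_nonneg (1 - y)) (by linarith : 0 ≤ 2 + y)]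
  set r := Real.sqrt ((1 - 3 * p) / (1 - p)) with hr
  have hr0 : 0 ≤ r := Real.sqrt_nonneg _
  have hp1 : 0 < 1 - p := by linarith
  have hr2 : (1 - p) * r ^ 2 = 1 - 3 * p := by
    rw [hr, Real.sq_sqrt (div_nonneg (by linarith) hp1.le)]
    field_simp
  have hyr : (1 - ε) * r ≤ y := by
    have h1 : (1 - ε) * (n / (1 - p) * r) ≤ n * x := by
      have := hs2
      unfold sEq at this
      rw [hsx] at this
      exact this
    have h2 : (1 - ε) * (n / (1 - p) * r) = n / (1 - p) * ((1 - ε) * r) := by ring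
    have h3 : (n : ℝ) * x = n / (1 - p) * y := by rw [hy]; field_simp
    rw [h2, h3] at h1
    exact le_of_mul_le_mul_left h1 (by positivity)
  have hy2 : (1 - ε) ^ 2 * (1 - 3 * p) ≤ (1 - p) * y ^ 2 := by
    have h1 := pow_le_pow_left₀ (mul_nonneg (by linarith) hr0) hyr 2
    have h2 := mul_le_mul_of_nonneg_left h1 hp1.le
    calc (1 - ε) ^ 2 * (1 - 3 * p) = (1 - p) * ((1 - ε) * r) ^ 2 := by rw [← hr2]; ring
      _ ≤ _ := h2
  have hdrift : (3 * y - y ^ 3) / 2 ≤ x * (1 + ε - 3 * p * ε) := by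
    have h1 : (3 * y - y ^ 3) / 2 = x * ((3 * (1 - p) - (1 - p) * y ^ 2) / 2) := by
      rw [hy]; ring
    rw [h1]
    apply mul_le_mul_of_nonneg_left _ hx0
    nlinarith [mul_nonneg (sq_nonneg ε) (by linarith : 0 ≤ 1 - 3 * p)]
  have hB : ∀ k, 0 ≤ binomProb n p s k := by
    intro k
    unfold binomProb
    have : 0 ≤ 1 - qStep n p s := sub_nonneg.2 hq1
    have : 0 ≤ qStep n p s := hq0
    positivity
  have hpe : p * ε ≤ 1 / 3 := by nlinarith
  have hpe0 : 0 ≤ p * ε := by positivity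
  have htail := aux_tail n q (3 * (p * ε) * x) (3 * (p * ε) * x * n / 2) hq0 hq1
    (by positivity) (by nlinarith)
  -- split
  have hsplit : 1 - ∑ k ∈ Finset.range (n + 1), ((n.choose k : ℝ) * q ^ k * (1 - q) ^ (n - k)) *
      Real.exp (3 * (p * ε) * x * ((k : ℝ) - n * q - 3 * (p * ε) * x * n / 2)) ≤
      stepProb n p s (fun x => (x : ℝ) ≤ (1 + ε) * (s : ℝ)) := by
    rw [sub_le_iff_le_add]
    refine (aux_sum n p s).symm.le.trans ?_
    unfold stepProb
    rw [← Finset.sum_add_distrib]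
    apply Finset.sum_le_sum
    intro k _
    change binomProb n p s k ≤ _ + binomProb n p s k * _
    split_ifs with hA
    · have := mul_nonneg (hB k)
        (Real.exp_pos (3 * (p * ε) * x * ((k : ℝ) - n * q - 3 * (p * ε) * x * n / 2))).le
      linarith
    · rw [zero_add]
      apply le_mul_of_one_le_right (hB k)
      apply Real.one_le_exp
      apply mul_nonneg (by positivity)
      push Not at hA
      push_cast at hA
      rw [hsx] at hA
      rw [hq]
      have := mul_le_mul_of_nonneg_left hdrift hn0.le
      nlinarith
  refine le_trans ?_ hsplit
  have hfin : Real.exp (n * ((3 * (p * ε) * x) ^ 2 / 4) -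
      3 * (p * ε) * x * (3 * (p * ε) * x * n / 2)) ≤ (n : ℝ) ^ (-(γ ^ 2 * ε ^ 2 * p ^ 2)) := by
    rw [Real.rpow_def_of_pos hn0, Real.exp_le_exp]
    have hlog : 0 ≤ Real.log n := Real.log_nonneg hn1
    have h1 := pow_le_pow_left₀ (by positivity) hs1 2
    rw [mul_pow, Real.sq_sqrt (by positivity), hsx] at h1
    have h2 : γ ^ 2 * Real.log n ≤ n * x ^ 2 := by
      have : (n : ℝ) * (γ ^ 2 * Real.log n) ≤ n * (n * x ^ 2) := by linarith
      exact le_of_mul_le_mul_left this hn0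
    have h3 := mul_le_mul_of_nonneg_left h2 (sq_nonneg (p * ε))
    have h4 : 0 ≤ (p * ε) ^ 2 * (n * x ^ 2) := by positivity
    have h5 : n * ((3 * (p * ε) * x) ^ 2 / 4) - 3 * (p * ε) * x * (3 * (p * ε) * x * n / 2) =
        -(9 / 4) * ((p * ε) ^ 2 * (n * x ^ 2)) := by ring
    have h6 : Real.log n * (-(γ ^ 2 * ε ^ 2 * p ^ 2)) =
        -((p * ε) ^ 2 * (γ ^ 2 * Real.log n)) := by ring
    rw [h5, h6]
    linarith
  linarith
end

section
/- Let p < 1/3, let γ > 0 be a constant, and let ε > 0 be a constant with ε < 1/3 and ε² < (1−3p)/2. For the 3-Majority dynamics with uniform noise probability p and all sufficiently large n, if s is a bias value with |s_eq − s| ≤ (ε/4)·s_eq, then P( |s_eq − s_t| ≤ ε·s_eq | s_{t−1} = s ) ≥ 1 − n^{−γ²ε²p²/2⁵}. -/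
/-- MGF bound for the centred binomial. -/
lemma binom_mgf (n : ℕ) (q l : ℝ) (h0 : 0 ≤ q) (h1 : q ≤ 1) (hl : |l| ≤ 1) :
    ∑ k ∈ Finset.range (n + 1), ((n.choose k : ℝ) * q ^ k * (1 - q) ^ (n - k)) *
      Real.exp (l * ((k : ℝ) - n * q)) ≤ Real.exp (n * l ^ 2) := by
  have e : ∑ k ∈ Finset.range (n + 1), ((n.choose k : ℝ) * q ^ k * (1 - q) ^ (n - k)) *
      Real.exp (l * ((k : ℝ) - n * q)) =
      (q * Real.exp (l * (1 - q)) + (1 - q) * Real.exp (-(l * q))) ^ n := by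
    rw [add_pow]
    apply Finset.sum_congr rfl
    intro k hk
    have hk' : k ≤ n := by simpa [Nat.lt_succ_iff] using hk
    rw [mul_pow, mul_pow, ← Real.exp_nat_mul, ← Real.exp_nat_mul]
    have : l * ((k : ℝ) - n * q) = k * (l * (1 - q)) + ((n - k : ℕ) : ℝ) * (-(l * q)) := by
      rw [Nat.cast_sub hk']; ring
    rw [this, Real.exp_add]; ring
  rw [e, Real.exp_nat_mul]
  have b : ∀ x : ℝ, |x| ≤ 1 → Real.exp x ≤ 1 + x + x ^ 2 := fun x hx => by
    have := (abs_le.1 (Real.abs_exp_sub_one_sub_id_le hx)).2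
    linarith
  have q1 : |1 - q| ≤ 1 := by rw [abs_le]; constructor <;> linarith
  have q2 : |q| ≤ 1 := by rw [abs_le]; constructor <;> linarith
  have b1 := b (l * (1 - q)) (by rw [abs_mul]; exact mul_le_one₀ hl (abs_nonneg _) q1)
  have b2 := b (-(l * q)) (by rw [abs_neg, abs_mul]; exact mul_le_one₀ hl (abs_nonneg _) q2)
  have h1' : 0 ≤ 1 - q := by linarith
  apply pow_le_pow_left₀ (by positivity)
  have c1 := mul_le_mul_of_nonneg_left b1 h0
  have c2 := mul_le_mul_of_nonneg_left b2 h1'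
  have c3 := Real.add_one_le_exp (l ^ 2)
  have c4 : q * (1 - q) * l ^ 2 ≤ 1 * l ^ 2 :=
    mul_le_mul_of_nonneg_right (by nlinarith) (sq_nonneg l)
  have c5 : q * (1 + l * (1 - q) + (l * (1 - q)) ^ 2) + (1 - q) * (1 + -(l * q) + (-(l * q)) ^ 2)
    = 1 + q * (1 - q) * l ^ 2 := by ring
  linarith

/-- Two-sided exponential tail bound, in the form of a lower bound for the good event. -/
lemma binom_tail (n : ℕ) (q d : ℝ) (h0 : 0 ≤ q) (h1 : q ≤ 1) (hd0 : 0 ≤ d) (hd1 : d ≤ 1)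
    (A : ℕ → Prop) [DecidablePred A] (hA : ∀ k, ¬ A k → n * d ≤ |(k : ℝ) - n * q|) :
    1 - 2 * Real.exp (-(d ^ 2 / 4) * n) ≤ ∑ k ∈ Finset.range (n + 1),
      if A k then (n.choose k : ℝ) * q ^ k * (1 - q) ^ (n - k) else 0 := by
  have m1 := binom_mgf n q (d / 2) h0 h1 (by rw [abs_le]; constructor <;> linarith)
  have m2 := binom_mgf n q (-(d / 2)) h0 h1 (by rw [abs_le]; constructor <;> linarith)
  have tot : ∑ k ∈ Finset.range (n + 1), (n.choose k : ℝ) * q ^ k * (1 - q) ^ (n - k) = 1 := by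
    have := add_pow q (1 - q) n
    rw [show q + (1 - q) = 1 by ring, one_pow] at this
    refine Eq.trans ?_ this.symm
    exact Finset.sum_congr rfl fun k _ => by ring
  set E := Real.exp (-(d ^ 2 / 2) * n) with hE
  have key : ∀ k ∈ Finset.range (n + 1), (n.choose k : ℝ) * q ^ k * (1 - q) ^ (n - k) -
      E * ((n.choose k : ℝ) * q ^ k * (1 - q) ^ (n - k) * Real.exp (d / 2 * ((k : ℝ) - n * q)))
      - E * ((n.choose k : ℝ) * q ^ k * (1 - q) ^ (n - k) *
        Real.exp (-(d / 2) * ((k : ℝ) - n * q)))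
      ≤ if A k then (n.choose k : ℝ) * q ^ k * (1 - q) ^ (n - k) else 0 := by
    intro k _
    have h1' : 0 ≤ 1 - q := by linarith
    have hB : 0 ≤ (n.choose k : ℝ) * q ^ k * (1 - q) ^ (n - k) := by positivity
    set B := (n.choose k : ℝ) * q ^ k * (1 - q) ^ (n - k)
    have hE0 : 0 < E := Real.exp_pos _
    have p1 : 0 ≤ E * (B * Real.exp (d / 2 * ((k : ℝ) - n * q))) := by positivity
    have p2 : 0 ≤ E * (B * Real.exp (-(d / 2) * ((k : ℝ) - n * q))) := by positivity
    split_ifs with h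
    · linarith
    · have hk := hA k h
      rcases le_abs.1 hk with hk | hk
      · have : 1 ≤ E * Real.exp (d / 2 * ((k : ℝ) - n * q)) := by
          rw [hE, ← Real.exp_add]
          apply Real.one_le_exp
          nlinarith
        have := mul_le_mul_of_nonneg_left this hB
        linarith
      · have : 1 ≤ E * Real.exp (-(d / 2) * ((k : ℝ) - n * q)) := by
          rw [hE, ← Real.exp_add]
          apply Real.one_le_exp
          nlinarith
        have := mul_le_mul_of_nonneg_left this hB
        linarith
  have S := Finset.sum_le_sum key
  rw [Finset.sum_sub_distrib, Finset.sum_sub_distrib, ← Finset.mul_sum, ← Finset.mul_sum, tot] at S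
  have f : E * Real.exp (n * (d / 2) ^ 2) = Real.exp (-(d ^ 2 / 4) * n) := by
    rw [hE, ← Real.exp_add]; congr 1; ring
  have f' : E * Real.exp (n * (-(d / 2)) ^ 2) = Real.exp (-(d ^ 2 / 4) * n) := by
    rw [hE, ← Real.exp_add]; congr 1; ring
  have g1 := mul_le_mul_of_nonneg_left m1 (Real.exp_pos (-(d ^ 2 / 2) * n)).le
  have g2 := mul_le_mul_of_nonneg_left m2 (Real.exp_pos (-(d ^ 2 / 2) * n)).le
  rw [← hE] at g1 g2
  linarith

/-- The relative deviation of the mean contracts. -/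
lemma drift_bound (p ε D : ℝ) (hp0 : 0 < p) (hp : p < 1 / 3) (hε1 : ε < 1 / 3)
    (hD : |D| ≤ ε / 4) :
    |(6 * p * D - (1 - 3 * p) * (3 * D ^ 2 + D ^ 3)) / 2| ≤ ε / 4 := by
  refine le_trans ?_ hD
  have hD1 : |D| ≤ 1 / 12 := by linarith
  have e : (6 * p * D - (1 - 3 * p) * (3 * D ^ 2 + D ^ 3)) / 2 =
    D * (3 * p - (1 - 3 * p) * ((3 * D + D ^ 2) / 2)) := by ring
  rw [e, abs_mul]
  apply mul_le_of_le_one_right (abs_nonneg _)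
  obtain ⟨a, b⟩ := abs_le.1 hD1
  have c1 : (3 * D + D ^ 2) / 2 ≤ 1 := by nlinarith
  have c2 : -1 ≤ (3 * D + D ^ 2) / 2 := by nlinarith
  rw [abs_le]; constructor <;> nlinarith

/-- Let `p < 1/3`, `γ > 0`, and `ε > 0` with `ε < 1/3` and
`ε² < (1−3p)/2`. For all sufficiently large `n`, if `|s_eq − s| ≤ (ε/4)s_eq`, then
`P(|s_eq − s_t| ≤ ε·s_eq | s_{t−1} = s) ≥ 1 − n^{−γ²ε²p²/2⁵}`. -/
theorem bias_stays_near_equilibrium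
    (p ε γ : ℝ) (hp0 : 0 < p) (hp : p < 1 / 3) (hγ : 0 < γ)
    (hε0 : 0 < ε) (hε1 : ε < 1 / 3) (hε2 : ε ^ 2 < (1 - 3 * p) / 2) :
    ∃ N : ℕ, ∀ n : ℕ, N ≤ n → ∀ s : ℤ,
      |sEq n p - (s : ℝ)| ≤ ε / 4 * sEq n p →
      1 - (n : ℝ) ^ (-(γ ^ 2 * ε ^ 2 * p ^ 2 / 2 ^ 5)) ≤
        stepProb n p s (fun x => |sEq n p - (x : ℝ)| ≤ ε * sEq n p) := by
  set r := Real.sqrt ((1 - 3 * p) / (1 - p)) with hr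
  have hp1 : 0 < 1 - p := by linarith
  have hp3 : 0 < 1 - 3 * p := by linarith
  have hr0 : 0 < r := Real.sqrt_pos.2 (by positivity)
  have hr2 : r ^ 2 * (1 - p) = 1 - 3 * p := by
    rw [hr, Real.sq_sqrt (by positivity)]; field_simp
  have hr1 : r ≤ 1 := by
    by_contra h
    push Not at h
    have h2 : 1 < r ^ 2 := by nlinarith
    nlinarith
  set y := r / (1 - p) with hy
  have hy0 : 0 < y := by positivity
  set d := min 1 (3 * ε * y / 8) with hd
  have hd0 : 0 < d := lt_min one_pos (by positivity)
  have hd1 : d ≤ 1 := min_le_left _ _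
  have hd2 : d ≤ 3 * ε * y / 8 := min_le_right _ _
  set C := γ ^ 2 * ε ^ 2 * p ^ 2 / 2 ^ 5 with hC
  have lim := (tendsto_rpow_mul_exp_neg_mul_atTop_nhds_zero C (d ^ 2 / 4)
    (by positivity)).comp (tendsto_natCast_atTop_atTop (R := ℝ))
  have ev := lim.eventually (gt_mem_nhds (show (0 : ℝ) < 1 / 2 by norm_num))
  obtain ⟨N, hN⟩ := Filter.eventually_atTop.1 ev
  refine ⟨max N 1, fun n hn s hs => ?_⟩
  have hn0 : (0 : ℝ) < n := by exact_mod_cast (le_max_right N 1).trans hn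
  have hNn := hN n ((le_max_left N 1).trans hn)
  simp only [Function.comp] at hNn
  have fin : 2 * Real.exp (-(d ^ 2 / 4) * n) ≤ (n : ℝ) ^ (-C) := by
    rw [Real.rpow_neg hn0.le, ← one_div, le_div_iff₀ (Real.rpow_pos_of_pos hn0 C)]
    linarith
  have hS : sEq n p = n * y := by rw [sEq, hy]; ring
  rw [hS] at hs ⊢
  have hS0 : 0 < n * y := by positivity
  obtain ⟨D, hD⟩ : ∃ D : ℝ, (s : ℝ) = n * y * (1 + D) :=
    ⟨(s : ℝ) / (n * y) - 1, by field_simp; ring⟩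
  have hDa : |D| ≤ ε / 4 := by
    rw [hD, show n * y - n * y * (1 + D) = -(n * y * D) by ring, abs_neg, abs_mul,
      abs_of_pos hS0] at hs
    exact le_of_mul_le_mul_left (by linarith) hS0
  have hq : qStep n p s = 1 / 2 + (3 * (r * (1 + D)) - (r * (1 + D)) ^ 3) / 4 := by
    rw [qStep, hD, hy]; field_simp; ring
  set q := qStep n p s with hqd
  obtain ⟨D1, D2⟩ := abs_le.1 hDa
  set u := r * (1 + D) with hu
  have hu0 : 0 ≤ u := mul_nonneg hr0.le (by linarith)
  have hu2 : u ≤ 2 := by nlinarith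
  have q0 : 0 ≤ q := by
    rw [hq]; nlinarith [mul_nonneg (sub_nonneg.2 hu2) (sq_nonneg (u + 1))]
  have q1 : q ≤ 1 := by
    rw [hq]; nlinarith [mul_nonneg (add_nonneg hu0 zero_le_two) (sq_nonneg (u - 1))]
  have mean : 2 * q - 1 - y = y * ((6 * p * D - (1 - 3 * p) * (3 * D ^ 2 + D ^ 3)) / 2) := by
    have hry : r = y * (1 - p) := by rw [hy]; field_simp
    rw [hq, hu, ← hr2]
    have e3 : r ^ 3 = y * (1 - 3 * p) := by
      calc r ^ 3 = r ^ 2 * r := by ring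
        _ = y * (r ^ 2 * (1 - p)) := by rw [hry]; ring
        _ = _ := by rw [hr2]
    rw [hr2, mul_pow, e3]
    linear_combination (3 * (1 + D) / 2) * hry
  have dr := drift_bound p ε D hp0 hp hε1 hDa
  have mdev : |2 * q - 1 - y| ≤ y * (ε / 4) := by
    rw [mean, abs_mul, abs_of_pos hy0]
    exact mul_le_mul_of_nonneg_left dr hy0.le
  classical
  have T := binom_tail n q d q0 q1 hd0.le hd1
    (fun k => |n * y - ((2 * (k : ℤ) - (n : ℤ) : ℤ) : ℝ)| ≤ ε * (n * y)) (by
      intro k hk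
      simp only [not_le] at hk
      push_cast at hk
      by_contra hlt
      push Not at hlt
      have e : (n : ℝ) * y - (2 * k - n) = n * (-(2 * q - 1 - y)) + (-2) * (k - n * q) := by ring
      rw [e] at hk
      have t := abs_add_le (n * (-(2 * q - 1 - y))) ((-2) * ((k : ℝ) - n * q))
      rw [abs_mul, abs_mul, abs_neg, abs_of_pos hn0,
        show |(-2 : ℝ)| = 2 by norm_num] at t
      have t1 := mul_le_mul_of_nonneg_left mdev hn0.le
      have t2 := mul_le_mul_of_nonneg_left hd2 hn0.le
      linarith)
  have : stepProb n p s (fun x => |n * y - (x : ℝ)| ≤ ε * (n * y)) =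
      ∑ k ∈ Finset.range (n + 1),
      if |n * y - ((2 * (k : ℤ) - (n : ℤ) : ℤ) : ℝ)| ≤ ε * (n * y) then
        (n.choose k : ℝ) * q ^ k * (1 - q) ^ (n - k) else 0 := by
    simp only [stepProb, binomProb, ← hqd]
  rw [this]
  refine le_trans ?_ (le_trans T (le_of_eq ?_))
  · linarith
  · exact Finset.sum_congr rfl fun k _ => by congr
end
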